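/- (Theorem 1, eq. (1)) For all integers m ≥ 1, d ≥ 1, the following identity of formal power series over ℤ holds: S_{m,d}(x^d) = G^{⟨0,0⟩}_{m,d}(x); equivalently, s_{m,d}(n) = g^{⟨0,0⟩}_{m,d}(dn) for every n ≥ 0. -/

import Mathlib

/-- A step of a lattice path: up `(1,1)`, down `(1,-1)`, or horizontal `(1,0)`. -/
inductive DStep : Type
  | U : DStep
  | D : DStep
  | L : DStep
  deriving DecidableEq

/-- The vertical displacement of a step. -/
def DStep.val : DStep → ℤ
  | .U => 1
  | .D => -1
  | .L => 0

/-- Total vertical displacement of a word of steps. -/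
def stepSum (w : List DStep) : ℤ := (w.map DStep.val).sum

/-- A word of the form `D^a L^b U^c` with `a + b + c = d`. -/
def IsPieceWord (d : ℕ) (p : List DStep) : Prop :=
  ∃ a b c : ℕ, a + b + c = d ∧
    p = List.replicate a DStep.D ++ List.replicate b DStep.L ++ List.replicate c DStep.U

/-- `M` is a DLU path of length `d*n` from `(0,s)` to `(d*n,t)`:
each consecutive block (piece) of `d` steps has the form `D^a L^b U^c`,
the path starts at height `s`, ends at height `t`, and never passes below the x-axis. -/
def IsDLUPath (d n s t : ℕ) (M : List DStep) : Prop :=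
  M.length = d * n ∧
  (∀ i < n, IsPieceWord d ((M.drop (d * i)).take d)) ∧
  (s : ℤ) + stepSum M = (t : ℤ) ∧
  ∀ k ≤ M.length, 0 ≤ (s : ℤ) + stepSum (M.take k)

/-- The completed path `M̂ = L^{d-s} U^s M D^t L^{d-t}`. -/
def hatPath (d s t : ℕ) (M : List DStep) : List DStep :=
  List.replicate (d - s) DStep.L ++ List.replicate s DStep.U ++ M ++
    List.replicate t DStep.D ++ List.replicate (d - t) DStep.L

/-- `w` contains a contiguous subpath `U P D` with `P ∈ {∅, L^d, L^{2d}, …, L^{(m-2)d}}`. -/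
def HasShortUD (m d : ℕ) (w : List DStep) : Prop :=
  ∃ k : ℕ, k + 2 ≤ m ∧
    ([DStep.U] ++ List.replicate (k * d) DStep.L ++ [DStep.D]) <:+: w

/-- `w` is `m`-regular: it contains no subpath `U P D` with
`P ∈ {∅, L^d, L^{2d}, …, L^{(m-2)d}}`. -/
def RegularWord (m d : ℕ) (w : List DStep) : Prop := ¬ HasShortUD m d w

/-- `w` has pattern `Λ`: it contains a contiguous subpath `U U P D D` in which the two `U`'s
lie in a common piece (block of `d` steps), the two `D`'s lie in a common piece, and `P`
starts and ends at the same height `h` and never passes below height `h`. -/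
def HasLambda (d : ℕ) (w : List DStep) : Prop :=
  ∃ pre P suf : List DStep,
    w = pre ++ [DStep.U, DStep.U] ++ P ++ [DStep.D, DStep.D] ++ suf ∧
    (pre.length + 1) % d ≠ 0 ∧
    (pre.length + P.length + 3) % d ≠ 0 ∧
    stepSum P = 0 ∧
    (∀ k ≤ P.length, 0 ≤ stepSum (P.take k))

/-- An `m`-regular `Λ`-avoiding DLU path of length `d*n` from `(0,s)` to `(d*n,t)`:
the regularity and `Λ`-avoidance conditions are imposed on the completed path `M̂`. -/
def IsGoodPath (m d n s t : ℕ) (M : List DStep) : Prop :=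
  IsDLUPath d n s t M ∧ RegularWord m d (hatPath d s t M) ∧ ¬ HasLambda d (hatPath d s t M)

/-- A prime path: an `m`-regular `Λ`-avoiding DLU path which never touches the x-axis. -/
def IsPrimePath (m d n s t : ℕ) (M : List DStep) : Prop :=
  IsGoodPath m d n s t M ∧ ∀ k ≤ M.length, 0 < (s : ℤ) + stepSum (M.take k)

/-- `g^{⟨s,t⟩}_{m,d}(dn)`: the number of `m`-regular `Λ`-avoiding DLU paths of
length `d*n` from `(0,s)` to `(d*n,t)`. -/
noncomputable def gCount (m d n s t : ℕ) : ℕ := {M : List DStep | IsGoodPath m d n s t M}.ncard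

/-- `a^{⟨s,t⟩}_{m,d}(dn)`: the number of prime `m`-regular `Λ`-avoiding DLU paths of
length `d*n` from `(0,s)` to `(d*n,t)`. -/
noncomputable def aCount (m d n s t : ℕ) : ℕ := {M : List DStep | IsPrimePath m d n s t M}.ncard

/-- The generating function `G^{⟨s,t⟩}_{m,d}(x) = Σ_{n≥0} g^{⟨s,t⟩}_{m,d}(dn) x^{dn}`. -/
noncomputable def Gps (m d s t : ℕ) : PowerSeries ℤ :=
  PowerSeries.mk fun N => if d ∣ N then (gCount m d (N / d) s t : ℤ) else 0

/-- The generating function `A^{⟨s,t⟩}_{m,d}(x) = Σ_{n≥0} a^{⟨s,t⟩}_{m,d}(dn) x^{dn}`. -/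
noncomputable def Aps (m d s t : ℕ) : PowerSeries ℤ :=
  PowerSeries.mk fun N => if d ∣ N then (aCount m d (N / d) s t : ℤ) else 0

/-- `C_{m,d}(x) = (x^{d(m-1)} - 1)/(x^d - 1) = Σ_{k=0}^{m-2} x^{dk}`. -/
noncomputable def Cps (m d : ℕ) : PowerSeries ℤ :=
  ∑ k ∈ Finset.range (m - 1), (PowerSeries.X : PowerSeries ℤ) ^ (d * k)

/-- `S` is a `d`-contact stack on `[n]`: a set of arcs `(i,j)` with `1 ≤ i < j ≤ n`,
noncrossing, in which every vertex lies in at most `d` arcs. -/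
def IsContactStack (d n : ℕ) (S : Finset (ℕ × ℕ)) : Prop :=
  (∀ p ∈ S, 1 ≤ p.1 ∧ p.1 < p.2 ∧ p.2 ≤ n) ∧
  (∀ p ∈ S, ∀ q ∈ S, ¬ (p.1 < q.1 ∧ q.1 < p.2 ∧ p.2 < q.2)) ∧
  (∀ v : ℕ, (S.filter fun p => p.1 = v ∨ p.2 = v).card ≤ d)

/-- Every arc of `S` has length at least `m`. -/
def ArcsRegular (m : ℕ) (S : Finset (ℕ × ℕ)) : Prop := ∀ p ∈ S, m ≤ p.2 - p.1

/-- `S` is an `m`-regular `d`-contact stack on `[n]`. -/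
def IsStack (m d n : ℕ) (S : Finset (ℕ × ℕ)) : Prop :=
  IsContactStack d n S ∧ ArcsRegular m S

/-- The left degree of vertex `v`: the number of arcs ending at `v`. -/
def ldeg (S : Finset (ℕ × ℕ)) (v : ℕ) : ℕ := (S.filter fun p => p.2 = v).card

/-- The right degree of vertex `v`: the number of arcs starting at `v`. -/
def rdeg (S : Finset (ℕ × ℕ)) (v : ℕ) : ℕ := (S.filter fun p => p.1 = v).card

/-- The map `η`, sending a stack `S` on `[n]` to the word `P_1 P_2 ⋯ P_n` where
`P_v = D^{ldeg v} L^{d - ldeg v - rdeg v} U^{rdeg v}`. -/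
def eta (d n : ℕ) (S : Finset (ℕ × ℕ)) : List DStep :=
  (List.range n).flatMap fun i =>
    List.replicate (ldeg S (i + 1)) DStep.D ++
      List.replicate (d - ldeg S (i + 1) - rdeg S (i + 1)) DStep.L ++
      List.replicate (rdeg S (i + 1)) DStep.U

/-- `s_{m,d}(n)`: the number of `m`-regular `d`-contact stacks on `[n]`. -/
noncomputable def sCount (m d n : ℕ) : ℕ := {S : Finset (ℕ × ℕ) | IsStack m d n S}.ncard

/-- The generating function `S_{m,d}(x) = Σ_{n≥0} s_{m,d}(n) xⁿ`. -/
noncomputable def Sps (m d : ℕ) : PowerSeries ℤ := PowerSeries.mk fun n => (sCount m d n : ℤ)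

section Abstract

/-- Height function of an infinite step sequence. -/
def Ht (s : ℕ → DStep) (k : ℕ) : ℤ := ∑ p ∈ Finset.range k, (s p).val

theorem Ht_succ (s : ℕ → DStep) (k : ℕ) : Ht s (k + 1) = Ht s k + (s k).val := by
  simp [Ht, Finset.sum_range_succ]

/-- The up step at `q` is matched with the down step at `p`. -/
def Mt (s : ℕ → DStep) (q p : ℕ) : Prop :=
  q < p ∧ s q = DStep.U ∧ s p = DStep.D ∧ Ht s (p + 1) = Ht s q ∧
    ∀ k, q < k → k ≤ p → Ht s q < Ht s k

/-- A closed nonnegative path with blocks of the form `D^a L^b U^c`. -/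
structure Nice (d N : ℕ) (s : ℕ → DStep) : Prop where
  pos : ∀ k, 0 ≤ Ht s k
  out : ∀ p, N ≤ p → s p = DStep.L
  fin : Ht s N = 0
  up : ∀ q t, q ≤ t → q / d = t / d → s q = DStep.U → s t = DStep.U
  dn : ∀ q t, q ≤ t → q / d = t / d → s t = DStep.D → s q = DStep.D

theorem val_le (x : DStep) : x.val ≤ 1 := by cases x <;> simp [DStep.val]
theorem val_ge (x : DStep) : -1 ≤ x.val := by cases x <;> simp [DStep.val]
theorem val_pos {x : DStep} (h : 0 < x.val) : x = DStep.U := by cases x <;> simp_all [DStep.val]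
theorem val_neg {x : DStep} (h : x.val < 0) : x = DStep.D := by cases x <;> simp_all [DStep.val]

variable {d N : ℕ} {s : ℕ → DStep}

theorem Nice.lt_of_ne (hs : Nice d N s) {p : ℕ} (h : s p ≠ DStep.L) : p < N := by
  by_contra h'
  exact h (hs.out p (by omega))

theorem Mt.exU (hs : Nice d N s) {q : ℕ} (hq : s q = DStep.U) : ∃ p, Mt s q p := by
  classical
  have hqN : q < N := hs.lt_of_ne (by simp [hq])
  have hex : ∃ k, q < k ∧ Ht s k ≤ Ht s q := ⟨N, hqN, by rw [hs.fin]; exact hs.pos q⟩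
  obtain ⟨h1, h2⟩ := Nat.find_spec hex
  have hmin : ∀ k, k < Nat.find hex → ¬ (q < k ∧ Ht s k ≤ Ht s q) := fun k hk => Nat.find_min hex hk
  generalize Nat.find hex = m at *
  have e1 := Ht_succ s q
  rw [hq] at e1
  simp only [DStep.val] at e1
  obtain ⟨p, rfl⟩ : ∃ p, m = p + 1 := ⟨m - 1, by omega⟩
  have hqp : q ≠ p := by rintro rfl; omega
  have h3 := hmin p (by omega)
  have h4 : Ht s q < Ht s p := by
    by_contra h; exact h3 ⟨by omega, by omega⟩
  have e2 := Ht_succ s p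
  have hpD : s p = DStep.D := val_neg (by omega)
  have := val_ge (s p)
  refine ⟨p, by omega, hq, hpD, by omega, fun k hk hk' => ?_⟩
  by_contra h
  exact hmin k (by omega) ⟨hk, by omega⟩

theorem Mt.exD (hs : Nice d N s) {p : ℕ} (hp : s p = DStep.D) : ∃ q, Mt s q p := by
  classical
  have e2 := Ht_succ s p
  rw [hp] at e2
  simp only [DStep.val] at e2
  let P : ℕ → Prop := fun k => Ht s k ≤ Ht s (p + 1)
  have h0 : P 0 := by
    have := hs.pos (p + 1)
    simpa [P, Ht] using this
  have hspec : P (Nat.findGreatest P p) := Nat.findGreatest_spec (Nat.zero_le p) h0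
  have hle : Nat.findGreatest P p ≤ p := Nat.findGreatest_le p
  have hgr : ∀ k, Nat.findGreatest P p < k → k ≤ p → ¬ P k :=
    fun k h1 h2 => Nat.findGreatest_is_greatest h1 h2
  generalize Nat.findGreatest P p = q at *
  simp only [P] at *
  have hqp : q ≠ p := by rintro rfl; omega
  have h3 := hgr (q + 1) (by omega) (by omega)
  have e1 := Ht_succ s q
  have := val_le (s q)
  refine ⟨q, by omega, val_pos (by omega), hp, by omega, fun k hk hk' => ?_⟩
  have := hgr k hk hk'
  omega

theorem Mt.uniqR {q p p' : ℕ} (h : Mt s q p) (h' : Mt s q p') : p = p' := by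
  obtain ⟨a1, a2, a3, a4, a5⟩ := h
  obtain ⟨b1, b2, b3, b4, b5⟩ := h'
  rcases lt_trichotomy p p' with h | h | h
  · have := b5 (p + 1) (by omega) (by omega); omega
  · exact h
  · have := a5 (p' + 1) (by omega) (by omega); omega

theorem Mt.nest {q p q' p' : ℕ} (h : Mt s q p) (h' : Mt s q' p') (h1 : q < q') (h2 : q' < p) :
    p' < p := by
  obtain ⟨a1, a2, a3, a4, a5⟩ := h
  obtain ⟨b1, b2, b3, b4, b5⟩ := h'
  by_contra hc
  have e1 := a5 q' h1 h2.le
  rcases Nat.lt_or_ge p p' with h | h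
  · have := b5 (p + 1) (by omega) (by omega); omega
  · obtain rfl : p = p' := by omega
    omega

theorem Mt.uniqL {q q' p : ℕ} (h : Mt s q p) (h' : Mt s q' p) : q = q' := by
  rcases lt_trichotomy q q' with h1 | h1 | h1
  · have := h.nest h' h1 h'.1; omega
  · exact h1
  · have := h'.nest h h1 h.1; omega

theorem Mt.block_lt (hs : Nice d N s) {q p : ℕ} (h : Mt s q p) : q / d < p / d := by
  have h1 : q / d ≤ p / d := Nat.div_le_div_right h.1.le
  rcases h1.lt_or_eq with h2 | h2
  · exact h2
  · have := hs.up q p h.1.le h2 h.2.1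
    rw [h.2.2.1] at this
    cases this

theorem lt_of_div_lt {a b d : ℕ} (h : a / d < b / d) : a < b := by
  by_contra hc
  have : b / d ≤ a / d := Nat.div_le_div_right (by omega)
  omega

theorem Mt.noncross (hs : Nice d N s) {q p q' p' : ℕ} (h : Mt s q p) (h' : Mt s q' p') :
    ¬ (q / d < q' / d ∧ q' / d < p / d ∧ p / d < p' / d) := by
  rintro ⟨h1, h2, h3⟩
  have := h.nest h' (lt_of_div_lt h1) (lt_of_div_lt h2)
  have := lt_of_div_lt h3
  omega

theorem Ht_run_up {q r : ℕ} (h : ∀ t, q ≤ t → t < r → s t = DStep.U) :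
    ∀ k, q ≤ k → k ≤ r → Ht s k = Ht s q + (k - q) := by
  intro k hk
  induction k, hk using Nat.le_induction with
  | base => intro; simp
  | succ k hk ih =>
    intro hr
    rw [Ht_succ, ih (by omega), h k hk (by omega)]
    simp [DStep.val]; ring

theorem Ht_run_dn {q r : ℕ} (h : ∀ t, q ≤ t → t < r → s t = DStep.D) :
    ∀ k, q ≤ k → k ≤ r → Ht s k = Ht s q - (k - q) := by
  intro k hk
  induction k, hk using Nat.le_induction with
  | base => intro; simp
  | succ k hk ih =>
    intro hr
    rw [Ht_succ, ih (by omega), h k hk (by omega)]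
    simp [DStep.val]; ring

/-- The pattern `Λ` in terms of positions. -/
def LamPos (d : ℕ) (s : ℕ → DStep) : Prop :=
  ∃ q p, s q = DStep.U ∧ s (p + 1) = DStep.D ∧ q / d = (q + 1) / d ∧ p / d = (p + 1) / d ∧
    Mt s (q + 1) p

theorem LamPos.outer {q p : ℕ} (h1 : s q = DStep.U) (h2 : s (p + 1) = DStep.D)
    (h : Mt s (q + 1) p) : Mt s q (p + 1) := by
  obtain ⟨a1, a2, a3, a4, a5⟩ := h
  have e1 := Ht_succ s q
  have e2 := Ht_succ s (p + 1)
  rw [h1] at e1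
  rw [h2] at e2
  simp only [DStep.val] at e1 e2
  refine ⟨by omega, h1, h2, by omega, fun k hk hk' => ?_⟩
  rcases Nat.lt_or_ge (q + 1) k with h | h
  · rcases Nat.lt_or_ge p k with h' | h'
    · obtain rfl : k = p + 1 := by omega
      omega
    · have := a5 k h h'; omega
  · obtain rfl : k = q + 1 := by omega
    omega

theorem div_between {a b c d : ℕ} (h1 : a ≤ b) (h2 : b ≤ c) (h : a / d = c / d) :
    a / d = b / d ∧ b / d = c / d := by
  have := Nat.div_le_div_right (c := d) h1
  have := Nat.div_le_div_right (c := d) h2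
  omega

theorem Mt.inj_aux (hs : Nice d N s) (hl : ¬ LamPos d s) {q p q' p' : ℕ} (h : Mt s q p)
    (h' : Mt s q' p') (hq : q / d = q' / d) (hp : p / d = p' / d) : ¬ q < q' := by
  intro hlt
  apply hl
  have hb := h.block_lt hs
  have hb' := h'.block_lt hs
  have hq'p : q' < p := lt_of_div_lt (d := d) (by omega)
  have hpp := h.nest h' hlt hq'p
  obtain ⟨a1, a2, a3, a4, a5⟩ := h
  obtain ⟨b1, b2, b3, b4, b5⟩ := h'
  have hU : ∀ t, q ≤ t → t < q' + 1 → s t = DStep.U := fun t h1 h2 =>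
    hs.up q t h1 (div_between h1 (by omega : t ≤ q') hq).1 a2
  have hD : ∀ t, p' ≤ t → t < p + 1 → s t = DStep.D := fun t h1 h2 =>
    hs.dn t p (by omega) (div_between h1 (by omega : t ≤ p) hp.symm).2 a3
  have rU := Ht_run_up hU
  have rD := Ht_run_dn hD
  obtain ⟨r, rfl⟩ : ∃ r, p = r + 1 := ⟨p - 1, by omega⟩
  refine ⟨q, r, a2, a3, (div_between (by omega : q ≤ q + 1) (by omega : q + 1 ≤ q') hq).1,
    (div_between (by omega : p' ≤ r) (by omega : r ≤ r + 1) hp.symm).2, by omega,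
    hU _ (by omega) (by omega), hD _ (by omega) (by omega), ?_, ?_⟩
  · have e1 := rU (q + 1) (by omega) (by omega)
    have e2 := rD (r + 1) (by omega) (by omega)
    have e3 := rD (r + 1 + 1) (by omega) (by omega)
    push_cast at *
    omega
  · intro k hk hk'
    have e1 := rU (q + 1) (by omega) (by omega)
    have e4 := rU q' (by omega) (by omega)
    have e2 := rD (r + 1) (by omega) (by omega)
    have e3 := rD (r + 1 + 1) (by omega) (by omega)
    rcases Nat.lt_or_ge q' k with h | h
    · rcases Nat.lt_or_ge p' k with h' | h'
      · have := rD k (by omega) (by omega)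
        push_cast at *
        omega
      · have := b5 k h h'
        push_cast at *
        omega
    · have := rU k (by omega) (by omega)
      push_cast at *
      omega

theorem Mt.inj (hs : Nice d N s) (hl : ¬ LamPos d s) {q p q' p' : ℕ} (h : Mt s q p)
    (h' : Mt s q' p') (hq : q / d = q' / d) (hp : p / d = p' / d) : q = q' ∧ p = p' := by
  have h1 := h.inj_aux hs hl h' hq hp
  have h2 := h'.inj_aux hs hl h hq.symm hp.symm
  obtain rfl : q = q' := by omega
  exact ⟨rfl, h.uniqR h'⟩

/-- Short `U L^{kd} D` in terms of positions. -/
def ShortPos (m d : ℕ) (s : ℕ → DStep) : Prop :=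
  ∃ q k, k + 2 ≤ m ∧ s q = DStep.U ∧ s (q + k * d + 1) = DStep.D ∧
    ∀ t, q < t → t < q + k * d + 1 → s t = DStep.L

theorem Ht_run_L {q r : ℕ} (h : ∀ t, q ≤ t → t < r → s t = DStep.L) :
    ∀ k, q ≤ k → k ≤ r → Ht s k = Ht s q := by
  intro k hk
  induction k, hk using Nat.le_induction with
  | base => intro; simp
  | succ k hk ih =>
    intro hr
    rw [Ht_succ, ih (by omega), h k hk (by omega)]
    simp [DStep.val]

theorem ShortPos.mt {m : ℕ} (hd : 1 ≤ d) (h : ShortPos m d s) :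
    ∃ q p, Mt s q p ∧ p / d - q / d < m := by
  obtain ⟨q, k, hk, h1, h2, h3⟩ := h
  have r := Ht_run_L (q := q + 1) (r := q + k * d + 1) (fun t h h' => h3 t (by omega) h')
  have e1 := Ht_succ s q
  have e2 := Ht_succ s (q + k * d + 1)
  rw [h1] at e1
  rw [h2] at e2
  simp only [DStep.val] at e1 e2
  have e3 := r (q + k * d + 1) (by omega) (by omega)
  refine ⟨q, q + k * d + 1, ⟨by omega, h1, h2, by omega, fun t h h' => ?_⟩, ?_⟩
  · have := r t (by omega) h'; omega
  · have : (q + k * d + 1) / d ≤ q / d + k + 1 := by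
      rw [show q / d + k + 1 = (q + (k + 1) * d) / d by
        rw [Nat.add_mul_div_right _ _ (by omega)]; ring]
      apply Nat.div_le_div_right
      rw [add_mul]; omega
    omega

theorem ShortPos.of_mt {m : ℕ} (hd : 1 ≤ d) (hs : Nice d N s)
    (h : ∃ q p, Mt s q p ∧ p / d - q / d < m) : ShortPos m d s := by
  classical
  have hex : ∃ g q p, p - q = g ∧ Mt s q p ∧ p / d - q / d < m := by
    obtain ⟨q, p, h⟩ := h
    exact ⟨_, q, p, rfl, h⟩
  obtain ⟨q, p, hg, hM, hlt⟩ := Nat.find_spec hex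
  have hmin : ∀ k, k < Nat.find hex → ¬ _ := fun k hk => Nat.find_min hex hk
  generalize Nat.find hex = g at *
  subst hg
  have hb := hM.block_lt hs
  have hM' := hM
  obtain ⟨a1, a2, a3, a4, a5⟩ := hM
  have e2 := Ht_succ s p
  rw [a3] at e2
  have e1 := Ht_succ s q
  rw [a2] at e1
  simp only [DStep.val] at e1 e2
  have hnU : ∀ t, q < t → t < p → s t ≠ DStep.U := by
    intro t h1 h2 h3
    obtain ⟨r, hr⟩ := Mt.exU hs h3
    have h4 := hM'.nest hr h1 h2
    have h5 := hr.1
    refine hmin (r - t) (by omega) ⟨t, r, rfl, hr, ?_⟩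
    have := Nat.div_le_div_right (c := d) h1.le
    have := Nat.div_le_div_right (c := d) h4.le
    omega
  have hle : ∀ k, q + 1 ≤ k → k ≤ p → Ht s k = Ht s q + 1 := by
    intro k hk
    induction k, hk using Nat.le_induction with
    | base => intro; exact e1
    | succ k hk ih =>
      intro hr
      have h1 := ih (by omega)
      have h2 := a5 (k + 1) (by omega) hr
      have h3 := Ht_succ s k
      have h4 := val_le (s k)
      have h5 : ¬ 0 < (s k).val := fun h => hnU k (by omega) (by omega) (val_pos h)
      omega
  have hL : ∀ t, q < t → t < p → s t = DStep.L := by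
    intro t h1 h2
    have h3 := Ht_succ s t
    rw [hle t (by omega) (by omega), hle (t + 1) (by omega) (by omega)] at h3
    have h6 : (s t).val = 0 := by omega
    revert h6
    cases s t <;> simp [DStep.val]
  by_cases hpq : p = q + 1
  · subst hpq
    exact ⟨q, 0, by omega, a2, by simpa using a3, by intro t h1 h2; omega⟩
  · have hq1 : q / d < (q + 1) / d := by
      have h1 : q / d ≤ (q + 1) / d := Nat.div_le_div_right (by omega)
      rcases h1.lt_or_eq with h2 | h2
      · exact h2
      · have := hs.up q (q + 1) (by omega) h2 a2
        rw [hL (q + 1) (by omega) (by omega)] at this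
        cases this
    have hp1 : (p - 1) / d < p / d := by
      have h1 : (p - 1) / d ≤ p / d := Nat.div_le_div_right (by omega)
      rcases h1.lt_or_eq with h2 | h2
      · exact h2
      · have := hs.dn (p - 1) p (by omega) h2 a3
        rw [hL (p - 1) (by omega) (by omega)] at this
        cases this
    have hdq : d ∣ q + 1 := by
      by_contra hc
      rw [Nat.succ_div_of_not_dvd hc] at hq1
      omega
    have hdp : d ∣ p := by
      obtain ⟨r, rfl⟩ : ∃ r, p = r + 1 := ⟨p - 1, by omega⟩
      by_contra hc
      rw [Nat.succ_div_of_not_dvd hc] at hp1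
      simp at hp1
    rw [Nat.succ_div_of_dvd hdq] at hq1
    obtain ⟨x, hx⟩ := hdq
    obtain ⟨y, hy⟩ := hdp
    have hx' : q / d + 1 = x := by
      rw [← Nat.succ_div_of_dvd ⟨x, hx⟩, hx]
      exact Nat.mul_div_cancel_left _ (by omega)
    have hy' : p / d = y := by
      rw [hy]; exact Nat.mul_div_cancel_left _ (by omega)
    have hxy : x ≤ y := by
      have : d * x ≤ d * y := by omega
      exact Nat.le_of_mul_le_mul_left this (by omega)
    obtain ⟨k, rfl⟩ := Nat.exists_eq_add_of_le hxy
    have hkk : q + k * d + 1 = p := by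
      rw [hy, mul_add, ← hx]; ring
    exact ⟨q, k, by omega, a2, by rw [hkk]; exact a3, by rw [hkk]; exact hL⟩

end Abstract
section Counting

theorem uniq_aux {N : ℕ} {f g : ℕ → ℕ → ℕ}
    (hg : ∀ i j, g i j ≠ 0 → i < j ∧ j < N)
    (ncf : ∀ i j i' j', f i j ≠ 0 → f i' j' ≠ 0 → ¬ (i < i' ∧ i' < j ∧ j < j'))
    (row : ∀ i, ∑ j ∈ Finset.range N, f i j = ∑ j ∈ Finset.range N, g i j)
    {j : ℕ} (ih : ∀ k < j, ∀ i, f i k = g i k) {i i' : ℕ} (hii : i < i')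
    (h1 : f i j ≠ 0) (h2 : f i' j < g i' j) : False := by
  have hb := hg i' j (by omega)
  have hlt : ∑ k ∈ Finset.range N, f i' k < ∑ k ∈ Finset.range N, g i' k := by
    apply Finset.sum_lt_sum
    · intro k _
      rcases lt_trichotomy k j with h | h | h
      · exact (ih k h i').le
      · subst h; exact h2.le
      · by_contra hc
        exact ncf i j i' k h1 (by omega) ⟨hii, hb.1, h⟩
    · exact ⟨j, by simpa using hb.2, h2⟩
  exact absurd (row i') hlt.ne

theorem uniq_mult {N : ℕ} {f g : ℕ → ℕ → ℕ}
    (hf : ∀ i j, f i j ≠ 0 → i < j ∧ j < N)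
    (hg : ∀ i j, g i j ≠ 0 → i < j ∧ j < N)
    (ncf : ∀ i j i' j', f i j ≠ 0 → f i' j' ≠ 0 → ¬ (i < i' ∧ i' < j ∧ j < j'))
    (ncg : ∀ i j i' j', g i j ≠ 0 → g i' j' ≠ 0 → ¬ (i < i' ∧ i' < j ∧ j < j'))
    (row : ∀ i, ∑ j ∈ Finset.range N, f i j = ∑ j ∈ Finset.range N, g i j)
    (col : ∀ j, ∑ i ∈ Finset.range N, f i j = ∑ i ∈ Finset.range N, g i j) :
    ∀ j i, f i j = g i j := by
  intro j
  induction j using Nat.strong_induction_on with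
  | _ j ih =>
  have key : ∀ f g : ℕ → ℕ → ℕ, (∀ i j, f i j ≠ 0 → i < j ∧ j < N) →
      (∀ i j, g i j ≠ 0 → i < j ∧ j < N) →
      (∀ j, ∑ i ∈ Finset.range N, f i j = ∑ i ∈ Finset.range N, g i j) →
      (∀ i, f i j ≤ g i j) → ∀ i, f i j = g i j := by
    intro f g hf hg col hle i
    by_cases hi : i < N
    · exact (Finset.sum_eq_sum_iff_of_le (fun i _ => hle i)).1 (col j) i (by simpa using hi)
    · have h1 : f i j = 0 := by
        by_contra h; have := hf i j h; omega
      have h2 : g i j = 0 := by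
        by_contra h; have := hg i j h; omega
      rw [h1, h2]
  by_cases hA : ∀ i, f i j ≤ g i j
  · exact key f g hf hg col hA
  by_cases hB : ∀ i, g i j ≤ f i j
  · exact fun i => (key g f hg hf (fun j => (col j).symm) hB i).symm
  push Not at hA hB
  obtain ⟨i, hi⟩ := hA
  obtain ⟨i', hi'⟩ := hB
  exfalso
  rcases lt_trichotomy i i' with h | h | h
  · exact uniq_aux hg ncf row ih h (by omega) hi'
  · subst h; omega
  · exact uniq_aux hf ncg (fun i => (row i).symm) (fun k hk i => (ih k hk i).symm) h
      (by omega) hi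

open Classical in
/-- The finite set of matched pairs. -/
noncomputable def mE (N : ℕ) (s : ℕ → DStep) : Finset (ℕ × ℕ) :=
  (Finset.range N ×ˢ Finset.range N).filter fun x => Mt s x.1 x.2

/-- Number of matched pairs between block `i` and block `j`. -/
noncomputable def mult (d N : ℕ) (s : ℕ → DStep) (i j : ℕ) : ℕ :=
  ((mE N s).filter fun x => x.1 / d = i ∧ x.2 / d = j).card

/-- Number of occurrences of `x` in block `v`. -/
def cnt (d N : ℕ) (s : ℕ → DStep) (x : DStep) (v : ℕ) : ℕ :=
  ((Finset.range N).filter fun q => s q = x ∧ q / d = v).card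

variable {d N : ℕ} {s : ℕ → DStep}

theorem mem_mE (hs : Nice d N s) {x : ℕ × ℕ} : x ∈ mE N s ↔ Mt s x.1 x.2 := by
  simp only [mE, Finset.mem_filter, Finset.mem_product, Finset.mem_range, and_iff_right_iff_imp]
  intro h
  exact ⟨hs.lt_of_ne (by simp [h.2.1]), hs.lt_of_ne (by simp [h.2.2.1])⟩

theorem mE_rowcard (hs : Nice d N s) (i : ℕ) :
    ((mE N s).filter fun x => x.1 / d = i).card = cnt d N s DStep.U i := by
  unfold cnt
  apply Finset.card_bij (fun x _ => x.1)
  · intro x hx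
    rw [Finset.mem_filter, mem_mE hs] at hx
    simp only [Finset.mem_filter, Finset.mem_range]
    exact ⟨hs.lt_of_ne (by simp [hx.1.2.1]), hx.1.2.1, hx.2⟩
  · intro x hx y hy hxy
    rw [Finset.mem_filter, mem_mE hs] at hx hy
    have hx1 := hx.1
    rw [hxy] at hx1
    exact Prod.ext hxy (hx1.uniqR hy.1)
  · intro q hq
    simp only [Finset.mem_filter, Finset.mem_range] at hq
    obtain ⟨p, hp⟩ := Mt.exU hs hq.2.1
    exact ⟨(q, p), by rw [Finset.mem_filter, mem_mE hs]; exact ⟨hp, hq.2.2⟩, rfl⟩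

theorem mE_colcard (hs : Nice d N s) (j : ℕ) :
    ((mE N s).filter fun x => x.2 / d = j).card = cnt d N s DStep.D j := by
  unfold cnt
  apply Finset.card_bij (fun x _ => x.2)
  · intro x hx
    rw [Finset.mem_filter, mem_mE hs] at hx
    simp only [Finset.mem_filter, Finset.mem_range]
    exact ⟨hs.lt_of_ne (by simp [hx.1.2.2.1]), hx.1.2.2.1, hx.2⟩
  · intro x hx y hy hxy
    rw [Finset.mem_filter, mem_mE hs] at hx hy
    have hx1 := hx.1
    rw [hxy] at hx1
    exact Prod.ext (hx1.uniqL hy.1) hxy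
  · intro p hp
    simp only [Finset.mem_filter, Finset.mem_range] at hp
    obtain ⟨q, hq⟩ := Mt.exD hs hp.2.1
    exact ⟨(q, p), by rw [Finset.mem_filter, mem_mE hs]; exact ⟨hq, hp.2.2⟩, rfl⟩

theorem div_lt_of_lt {p N d : ℕ} (h : p < N) : p / d < N :=
  lt_of_le_of_lt (Nat.div_le_self p d) h

theorem mult_row (hs : Nice d N s) (i : ℕ) :
    ∑ j ∈ Finset.range N, mult d N s i j = cnt d N s DStep.U i := by
  rw [← mE_rowcard hs, Finset.card_eq_sum_card_fiberwise (f := fun x => x.2 / d)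
    (t := Finset.range N)]
  · simp only [mult, Finset.filter_filter]
  · intro x hx
    have hx : x ∈ (mE N s).filter fun x => x.1 / d = i := hx
    rw [Finset.mem_filter, mem_mE hs] at hx
    have : x.2 < N := hs.lt_of_ne (by simp [hx.1.2.2.1])
    simpa using div_lt_of_lt this

theorem mult_col (hs : Nice d N s) (j : ℕ) :
    ∑ i ∈ Finset.range N, mult d N s i j = cnt d N s DStep.D j := by
  rw [← mE_colcard hs, Finset.card_eq_sum_card_fiberwise (f := fun x => x.1 / d)
    (t := Finset.range N)]
  · simp only [mult, Finset.filter_filter, and_comm]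
  · intro x hx
    have hx : x ∈ (mE N s).filter fun x => x.2 / d = j := hx
    rw [Finset.mem_filter, mem_mE hs] at hx
    have : x.1 < N := hs.lt_of_ne (by simp [hx.1.2.1])
    simpa using div_lt_of_lt this

theorem mult_ne (hs : Nice d N s) {i j : ℕ} :
    mult d N s i j ≠ 0 ↔ ∃ q p, Mt s q p ∧ q / d = i ∧ p / d = j := by
  unfold mult
  rw [← Nat.pos_iff_ne_zero, Finset.card_pos]
  constructor
  · rintro ⟨x, hx⟩
    rw [Finset.mem_filter, mem_mE hs] at hx
    exact ⟨x.1, x.2, hx⟩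
  · rintro ⟨q, p, h⟩
    exact ⟨(q, p), by rw [Finset.mem_filter, mem_mE hs]; exact h⟩

/-- If the degrees of a stack agree with the block counts, the matching is the stack. -/
theorem mult_eq_stack {m n : ℕ} (hs : Nice d N s) (hnN : n < N) {S : Finset (ℕ × ℕ)}
    (hS : IsStack m d n S)
    (hU : ∀ v, cnt d N s DStep.U v = rdeg S v) (hD : ∀ v, cnt d N s DStep.D v = ldeg S v)
    (i j : ℕ) : mult d N s i j = if (i, j) ∈ S then 1 else 0 := by
  have hb : ∀ i j, (i, j) ∈ S → i < j ∧ j < N := by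
    intro i j h
    have := hS.1.1 _ h
    simp only at this
    omega
  apply uniq_mult (N := N) (f := mult d N s) (g := fun i j => if (i, j) ∈ S then 1 else 0)
  · intro i j h
    obtain ⟨q, p, h1, rfl, rfl⟩ := (mult_ne hs).1 h
    exact ⟨h1.block_lt hs, div_lt_of_lt (hs.lt_of_ne (by simp [h1.2.2.1]))⟩
  · intro i j h
    exact hb i j (by simpa using h)
  · intro i j i' j' h h'
    obtain ⟨q, p, h1, rfl, rfl⟩ := (mult_ne hs).1 h
    obtain ⟨q', p', h2, rfl, rfl⟩ := (mult_ne hs).1 h'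
    exact h1.noncross hs h2
  · intro i j i' j' h h'
    exact hS.1.2.1 (i, j) (by simpa using h) (i', j') (by simpa using h')
  · intro i
    rw [mult_row hs, hU, rdeg, Finset.sum_ite, Finset.sum_const_zero, add_zero,
      Finset.sum_const, smul_eq_mul, mul_one]
    apply Finset.card_bij (fun x _ => x.2)
    · rintro ⟨x, y⟩ hx
      simp only [Finset.mem_filter, Finset.mem_range] at hx ⊢
      obtain ⟨hx, rfl⟩ := hx
      exact ⟨(hb _ _ hx).2, hx⟩
    · rintro ⟨x, y⟩ hx ⟨x', y'⟩ hx' h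
      simp only [Finset.mem_filter] at hx hx' h
      simp [h, hx.2, hx'.2]
    · intro y hy
      simp only [Finset.mem_filter, Finset.mem_range] at hy
      exact ⟨(i, y), by simp [hy.2], rfl⟩
  · intro j
    rw [mult_col hs, hD, ldeg, Finset.sum_ite, Finset.sum_const_zero, add_zero,
      Finset.sum_const, smul_eq_mul, mul_one]
    apply Finset.card_bij (fun x _ => x.1)
    · rintro ⟨x, y⟩ hx
      simp only [Finset.mem_filter, Finset.mem_range] at hx ⊢
      obtain ⟨hx, rfl⟩ := hx
      have := hb _ _ hx
      exact ⟨by omega, hx⟩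
    · rintro ⟨x, y⟩ hx ⟨x', y'⟩ hx' h
      simp only [Finset.mem_filter] at hx hx' h
      simp [h, hx.2, hx'.2]
    · intro y hy
      simp only [Finset.mem_filter, Finset.mem_range] at hy
      exact ⟨(y, j), by simp [hy.2], rfl⟩

/-- The stack read off from the matching. -/
noncomputable def stackOf (d N : ℕ) (s : ℕ → DStep) : Finset (ℕ × ℕ) :=
  (mE N s).image fun x => (x.1 / d, x.2 / d)

theorem stackOf_injOn (hs : Nice d N s) (hl : ¬ LamPos d s) :
    Set.InjOn (fun x : ℕ × ℕ => (x.1 / d, x.2 / d)) (mE N s : Set (ℕ × ℕ)) := by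
  intro x hx y hy hxy
  have hx : x ∈ mE N s := hx
  have hy : y ∈ mE N s := hy
  rw [mem_mE hs] at hx hy
  simp only [Prod.mk.injEq] at hxy
  obtain ⟨h1, h2⟩ := hx.inj hs hl hy hxy.1 hxy.2
  exact Prod.ext h1 h2

theorem stackOf_rdeg (hs : Nice d N s) (hl : ¬ LamPos d s) (v : ℕ) :
    rdeg (stackOf d N s) v = cnt d N s DStep.U v := by
  rw [← mE_rowcard hs, rdeg, stackOf, Finset.filter_image, Finset.card_image_of_injOn]
  exact (stackOf_injOn hs hl).mono (by intro x hx; exact (Finset.mem_filter.1 hx).1)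

theorem stackOf_ldeg (hs : Nice d N s) (hl : ¬ LamPos d s) (v : ℕ) :
    ldeg (stackOf d N s) v = cnt d N s DStep.D v := by
  rw [← mE_colcard hs, ldeg, stackOf, Finset.filter_image, Finset.card_image_of_injOn]
  exact (stackOf_injOn hs hl).mono (by intro x hx; exact (Finset.mem_filter.1 hx).1)

theorem stackOf_isStack {m n : ℕ} (hd : 1 ≤ d) (hs : Nice d N s) (hl : ¬ LamPos d s)
    (hm : ¬ ShortPos m d s) (hn : ∀ p, s p ≠ DStep.L → 1 ≤ p / d ∧ p / d ≤ n)
    (hc : ∀ v, cnt d N s DStep.U v + cnt d N s DStep.D v ≤ d) :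
    IsStack m d n (stackOf d N s) := by
  have hmem : ∀ x ∈ stackOf d N s, ∃ q p, Mt s q p ∧ x = (q / d, p / d) := by
    intro x hx
    obtain ⟨y, hy, rfl⟩ := Finset.mem_image.1 hx
    exact ⟨_, _, (mem_mE hs).1 hy, rfl⟩
  refine ⟨⟨?_, ?_, ?_⟩, ?_⟩
  · intro x hx
    obtain ⟨q, p, h, rfl⟩ := hmem x hx
    exact ⟨(hn q (by simp [h.2.1])).1, h.block_lt hs, (hn p (by simp [h.2.2.1])).2⟩
  · intro x hx y hy
    obtain ⟨q, p, h, rfl⟩ := hmem x hx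
    obtain ⟨q', p', h', rfl⟩ := hmem y hy
    exact h.noncross hs h'
  · intro v
    rw [Finset.filter_or]
    refine (Finset.card_union_le _ _).trans ?_
    have h1 := stackOf_rdeg hs hl v
    have h2 := stackOf_ldeg hs hl v
    unfold rdeg at h1
    unfold ldeg at h2
    rw [h1, h2]
    exact hc v
  · intro x hx
    obtain ⟨q, p, h, rfl⟩ := hmem x hx
    by_contra hc
    exact hm (ShortPos.of_mt hd hs ⟨q, p, h, by simpa using hc⟩)

theorem not_lam_of_mult (hs : Nice d N s) (h : ∀ i j, mult d N s i j ≤ 1) : ¬ LamPos d s := by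
  rintro ⟨q, p, h1, h2, h3, h4, h5⟩
  have h6 := LamPos.outer h1 h2 h5
  have := h (q / d) (p / d)
  unfold mult at this
  rw [Finset.card_le_one] at this
  have := this (q, p + 1) (by rw [Finset.mem_filter, mem_mE hs]; exact ⟨h6, rfl, h4.symm⟩)
    (q + 1, p) (by rw [Finset.mem_filter, mem_mE hs]; exact ⟨h5, h3.symm, rfl⟩)
  simp at this

end Counting
section Words

/-- The step sequence of a word, padded with `L`. -/
def sqn (w : List DStep) (p : ℕ) : DStep := w.getD p DStep.L

theorem stepSum_append (u v : List DStep) : stepSum (u ++ v) = stepSum u + stepSum v := by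
  simp [stepSum]

theorem stepSum_replicate_L (k : ℕ) : stepSum (List.replicate k DStep.L) = 0 := by
  simp [stepSum, DStep.val]

theorem Ht_sq (w : List DStep) (k : ℕ) : Ht (sqn w) k = stepSum (w.take k) := by
  induction k with
  | zero => simp [Ht, stepSum]
  | succ k ih =>
    rw [Ht_succ, ih, List.take_add_one, stepSum_append]
    congr 1
    unfold sqn
    rw [List.getD_eq_getElem?_getD]
    cases w[k]? <;> simp [stepSum, DStep.val]

theorem sqn_append_add (u v : List DStep) (k : ℕ) : sqn (u ++ v) (u.length + k) = sqn v k := by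
  rw [sqn, sqn, List.getD_append_right _ _ _ _ (by omega), Nat.add_sub_cancel_left]

theorem sqn_append_length (u v : List DStep) : sqn (u ++ v) u.length = sqn v 0 :=
  sqn_append_add u v 0

theorem sqn_cons_succ (x : DStep) (v : List DStep) (k : ℕ) : sqn (x :: v) (k + 1) = sqn v k := by
  simp [sqn]

theorem sqn_cons_zero (x : DStep) (v : List DStep) : sqn (x :: v) 0 = x := by
  simp [sqn]

theorem sqn_lt {w : List DStep} {p : ℕ} (h : sqn w p ≠ DStep.L) : p < w.length := by
  by_contra hc
  apply h
  simp [sqn, List.getD_eq_getElem?_getD, List.getElem?_eq_none (by omega : w.length ≤ p)]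

theorem drop_of_sq {w : List DStep} {p : ℕ} {x : DStep} (hx : x ≠ DStep.L) (h : sqn w p = x) :
    w.drop p = x :: w.drop (p + 1) := by
  have hp : p < w.length := sqn_lt (by rw [h]; exact hx)
  rw [List.drop_eq_getElem_cons hp]
  congr 1
  rw [← h, sqn, List.getD_eq_getElem _ _ hp]

theorem lamH {pre P suf w : List DStep}
    (hw : w = pre ++ DStep.U :: DStep.U :: (P ++ DStep.D :: DStep.D :: suf)) {k : ℕ}
    (hk : k ≤ P.length) :
    Ht (sqn w) (pre.length + (k + 2)) = Ht (sqn w) pre.length + 2 + stepSum (P.take k) := by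
  rw [Ht_sq, Ht_sq, hw, List.take_length_add_append, stepSum_append, List.take_left']
  · rw [List.take_succ_cons, List.take_succ_cons, List.take_append_of_le_length hk]
    simp [stepSum, DStep.val]; ring
  · rfl

theorem succ_div_eq_iff {q d : ℕ} : q / d = (q + 1) / d ↔ (q + 1) % d ≠ 0 := by
  rw [Nat.succ_div, ne_eq, ← Nat.dvd_iff_mod_eq_zero]
  split_ifs with h <;> simp [h]

theorem lam_iff (d : ℕ) (w : List DStep) : HasLambda d w ↔ LamPos d (sqn w) := by
  constructor
  · rintro ⟨pre, P, suf, hw, h1, h2, h3, h4⟩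
    have hw' : w = pre ++ DStep.U :: DStep.U :: (P ++ DStep.D :: DStep.D :: suf) := by
      rw [hw]; simp
    have e0 : sqn w pre.length = DStep.U := by rw [hw', sqn_append_length, sqn_cons_zero]
    have e1 : sqn w (pre.length + 1) = DStep.U := by
      rw [hw', sqn_append_add, sqn_cons_succ, sqn_cons_zero]
    have e2 : sqn w (pre.length + (P.length + 2)) = DStep.D := by
      rw [hw', sqn_append_add, sqn_cons_succ, sqn_cons_succ, sqn_append_length, sqn_cons_zero]
    have e3 : sqn w (pre.length + (P.length + 2) + 1) = DStep.D := by
      rw [hw', add_assoc, show P.length + 2 + 1 = P.length + 1 + 1 + 1 by ring,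
        sqn_append_add, sqn_cons_succ, sqn_cons_succ, sqn_append_add, sqn_cons_succ, sqn_cons_zero]
    have f0 := Ht_succ (sqn w) pre.length
    have f2 := Ht_succ (sqn w) (pre.length + (P.length + 2))
    rw [e0] at f0
    rw [e2] at f2
    simp only [DStep.val] at f0 f2
    refine ⟨pre.length, pre.length + (P.length + 2), e0, e3, succ_div_eq_iff.2 h1,
      succ_div_eq_iff.2 (by rw [← add_assoc]; exact h2), by omega, e1, e2, ?_, ?_⟩
    · rw [f2, f0, lamH hw' le_rfl, List.take_length, h3]; ring
    · intro k hk hk'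
      obtain ⟨j, rfl⟩ : ∃ j, k = pre.length + (j + 2) := ⟨k - pre.length - 2, by omega⟩
      have hj : j ≤ P.length := by omega
      rw [lamH hw' hj, f0]
      have := h4 j hj
      omega
  · rintro ⟨q, p, h1, h2, h3, h4, h5, h6, h7, h8, h9⟩
    have hp : p + 1 < w.length := sqn_lt (by rw [h2]; simp)
    have g1 := drop_of_sq (by simp) h1
    have g2 := drop_of_sq (by simp) h6
    have g3 := drop_of_sq (by simp) h7
    have g4 := drop_of_sq (by simp) h2
    have hl : (w.take q).length = q := by rw [List.length_take]; omega
    set P := (w.drop (q + 1 + 1)).take (p - (q + 2)) with hP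
    have hPl : P.length = p - (q + 2) := by
      rw [hP, List.length_take, List.length_drop]; omega
    have g5 : w.drop (q + 1 + 1) = P ++ w.drop p := by
      conv_lhs => rw [← List.take_append_drop (p - (q + 2)) (w.drop (q + 1 + 1))]
      rw [List.drop_drop, show q + 1 + 1 + (p - (q + 2)) = p by omega]
    have hw' : w = w.take q ++ DStep.U :: DStep.U ::
        (P ++ DStep.D :: DStep.D :: w.drop (p + 1 + 1)) := by
      rw [← g4, ← g3, ← g5, ← g2, ← g1, List.take_append_drop]
    have f0 := Ht_succ (sqn w) q
    have f2 := Ht_succ (sqn w) p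
    rw [h1] at f0
    rw [h7] at f2
    simp only [DStep.val] at f0 f2
    have hH : ∀ k ≤ P.length, Ht (sqn w) (q + (k + 2)) = Ht (sqn w) q + 2 + stepSum (P.take k) := by
      intro k hk
      have := lamH hw' hk
      rwa [hl] at this
    refine ⟨w.take q, P, w.drop (p + 1 + 1), ?_, ?_, ?_, ?_, ?_⟩
    · conv_lhs => rw [hw']
      simp
    · rw [hl]; exact succ_div_eq_iff.1 h3
    · rw [hl, hPl, show q + (p - (q + 2)) + 3 = p + 1 by omega]; exact succ_div_eq_iff.1 h4
    · have := hH P.length le_rfl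
      rw [List.take_length, hPl, show q + (p - (q + 2) + 2) = p by omega] at this
      omega
    · intro k hk
      have e := hH k hk
      have := h9 (q + (k + 2)) (by omega) (by omega)
      omega

theorem short_iff (m d : ℕ) (w : List DStep) : HasShortUD m d w ↔ ShortPos m d (sqn w) := by
  constructor
  · rintro ⟨k, hk, pre, suf, hw⟩
    have hw' : w = pre ++ DStep.U :: (List.replicate (k * d) DStep.L ++ DStep.D :: suf) := by
      rw [← hw]; simp
    refine ⟨pre.length, k, hk, ?_, ?_, ?_⟩
    · rw [hw', sqn_append_length, sqn_cons_zero]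
    · rw [hw', add_assoc, sqn_append_add, sqn_cons_succ]
      have := sqn_append_length (List.replicate (k * d) DStep.L) (DStep.D :: suf)
      rw [List.length_replicate] at this
      rw [this, sqn_cons_zero]
    · intro t h1 h2
      obtain ⟨j, rfl⟩ : ∃ j, t = pre.length + (j + 1) := ⟨t - pre.length - 1, by omega⟩
      rw [hw', sqn_append_add, sqn_cons_succ, sqn, List.getD_append _ _ _ _ (by simp; omega)]
      rw [List.getD_eq_getElem _ _ (by simp; omega)]
      simp
  · rintro ⟨q, k, hk, h1, h2, h3⟩
    have hp : q + k * d + 1 < w.length := sqn_lt (by rw [h2]; simp)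
    have g1 := drop_of_sq (by simp) h1
    have g2 := drop_of_sq (by simp) h2
    have g3 : (w.drop (q + 1)).take (k * d) = List.replicate (k * d) DStep.L := by
      apply List.ext_getElem
      · simp; omega
      · intro i hi hi'
        have hi2 : i < k * d := by simpa using hi'
        simp only [List.getElem_take, List.getElem_drop, List.getElem_replicate]
        have := h3 (q + 1 + i) (by omega) (by omega)
        rwa [sqn, List.getD_eq_getElem _ _ (by omega)] at this
    refine ⟨k, hk, w.take q, w.drop (q + k * d + 1 + 1), ?_⟩
    have g4 : w.drop (q + 1) = List.replicate (k * d) DStep.L ++ w.drop (q + k * d + 1) := by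
      conv_lhs => rw [← List.take_append_drop (k * d) (w.drop (q + 1))]
      rw [g3, List.drop_drop, show q + 1 + k * d = q + k * d + 1 by omega]
    conv_rhs => rw [← List.take_append_drop q w, g1, g4, g2]
    simp

/-- Concatenation of equal-length blocks. -/
theorem flat_length {d : ℕ} {g : ℕ → List DStep} (hg : ∀ i, (g i).length = d) (K : ℕ) :
    ((List.range K).flatMap g).length = d * K := by
  induction K with
  | zero => simp
  | succ K ih => rw [List.range_succ, List.flatMap_append, List.length_append, ih]; simp [hg]; ring

theorem flat_block {d : ℕ} {g : ℕ → List DStep} (hg : ∀ i, (g i).length = d) (K : ℕ) :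
    ∀ i < K, (((List.range K).flatMap g).drop (d * i)).take d = g i := by
  induction K with
  | zero => intro i hi; omega
  | succ K ih =>
    intro i hi
    rw [List.range_succ, List.flatMap_append]
    have hl := flat_length hg K
    rcases Nat.lt_or_ge i K with h | h
    · have h1 : d * (i + 1) ≤ d * K := Nat.mul_le_mul_left d h
      rw [mul_add, mul_one] at h1
      rw [List.drop_append_of_le_length (by omega), List.take_append_of_le_length
        (by rw [List.length_drop]; omega), ih i h]
    · obtain rfl : i = K := by omega
      rw [List.drop_left' hl]
      simp [← hg i]

theorem flat_unique {d : ℕ} {g : ℕ → List DStep} (n : ℕ) :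
    ∀ M : List DStep, M.length = d * n →
    (∀ i < n, (M.drop (d * i)).take d = g i) → M = (List.range n).flatMap g := by
  induction n with
  | zero => intro M h _; simpa using h
  | succ n ih =>
    intro M hM h
    rw [mul_add, mul_one] at hM
    rw [List.range_succ, List.flatMap_append, ← ih (M.take (d * n))]
    · have := h n (by omega)
      rw [List.take_of_length_le (by rw [List.length_drop]; omega)] at this
      simp [← this]
    · rw [List.length_take]; omega
    · intro i hi
      rw [← h i (by omega), List.drop_take, List.take_take]
      congr 1
      have h1 : d * (i + 1) ≤ d * n := Nat.mul_le_mul_left d hi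
      rw [mul_add, mul_one] at h1
      omega

/-- The block `D^a L^{d-a-c} U^c`. -/
def pc (d a c : ℕ) : List DStep :=
  List.replicate a DStep.D ++ List.replicate (d - a - c) DStep.L ++ List.replicate c DStep.U

theorem pc_length {d a c : ℕ} (h : a + c ≤ d) : (pc d a c).length = d := by
  simp [pc]; omega

theorem pc_sq {d a c r : ℕ} (h : a + c ≤ d) (hr : r < d) :
    sqn (pc d a c) r = if r < a then DStep.D else if r + c < d then DStep.L else DStep.U := by
  unfold sqn pc
  split_ifs with h1 h2
  · rw [List.getD_append _ _ _ _ (by simp; omega), List.getD_append _ _ _ _ (by simp; omega),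
      List.getD_eq_getElem _ _ (by simpa using h1)]
    simp
  · rw [List.getD_append _ _ _ _ (by simp; omega), List.getD_append_right _ _ _ _ (by simp; omega),
      List.getD_eq_getElem _ _ (by simp; omega)]
    simp
  · rw [List.getD_append_right _ _ _ _ (by simp; omega),
      List.getD_eq_getElem _ _ (by simp; omega)]
    simp

theorem flat_sq {d : ℕ} (hd : 1 ≤ d) {g : ℕ → List DStep} (hg : ∀ i, (g i).length = d) {K p : ℕ}
    (hp : p / d < K) : sqn ((List.range K).flatMap g) p = sqn (g (p / d)) (p % d) := by
  have h := flat_block hg K (p / d) hp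
  rw [← h]
  have h1 : p % d < d := Nat.mod_lt _ hd
  have h2 := Nat.div_add_mod p d
  unfold sqn
  simp only [List.getD_eq_getElem?_getD]
  rw [List.getElem?_take_of_lt h1, List.getElem?_drop, h2]

/-- Abstract description of a block sequence. -/
structure Blk (d : ℕ) (s : ℕ → DStep) (a c : ℕ → ℕ) : Prop where
  le : ∀ v, a v + c v ≤ d
  isD : ∀ p, s p = DStep.D ↔ p % d < a (p / d)
  isU : ∀ p, s p = DStep.U ↔ d ≤ p % d + c (p / d)

theorem blk_flat {d : ℕ} (hd : 1 ≤ d) {a c : ℕ → ℕ} (hle : ∀ v, a v + c v ≤ d) {K : ℕ}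
    (ha : ∀ v, K ≤ v → a v = 0) (hc : ∀ v, K ≤ v → c v = 0) :
    Blk d (sqn ((List.range K).flatMap fun v => pc d (a v) (c v))) a c := by
  have hlen : ∀ v, (pc d (a v) (c v)).length = d := fun v => pc_length (hle v)
  have key : ∀ p, sqn ((List.range K).flatMap fun v => pc d (a v) (c v)) p =
      if p % d < a (p / d) then DStep.D else if p % d + c (p / d) < d then DStep.L
        else DStep.U := by
    intro p
    have h1 : p % d < d := Nat.mod_lt _ hd
    rcases Nat.lt_or_ge (p / d) K with h | h
    · rw [flat_sq hd hlen h, pc_sq (hle _) h1]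
    · rw [ha _ h, hc _ h]
      simp only [not_lt_zero, if_false, add_zero, h1, if_true]
      by_contra hne
      have h2 := sqn_lt hne
      rw [flat_length hlen, mul_comm] at h2
      have := (Nat.div_lt_iff_lt_mul hd).2 h2
      omega
  refine ⟨hle, fun p => ?_, fun p => ?_⟩
  · rw [key]
    split_ifs <;> simp_all
  · rw [key]
    have := hle (p / d)
    split_ifs with h1 h2
    · simp; omega
    · simp; omega
    · simp; omega

variable {d : ℕ} {s : ℕ → DStep} {a c : ℕ → ℕ}

theorem mod_le_of {q t : ℕ} (h : q ≤ t) (h' : q / d = t / d) : q % d ≤ t % d := by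
  have h1 := Nat.div_add_mod q d
  have h2 := Nat.div_add_mod t d
  rw [h'] at h1
  omega

theorem Blk.up (h : Blk d s a c) : ∀ q t, q ≤ t → q / d = t / d → s q = DStep.U → s t = DStep.U := by
  intro q t h1 h2 h3
  have := mod_le_of h1 h2
  rw [h.isU] at *
  rw [← h2]; omega

theorem Blk.dn (h : Blk d s a c) : ∀ q t, q ≤ t → q / d = t / d → s t = DStep.D → s q = DStep.D := by
  intro q t h1 h2 h3
  have := mod_le_of h1 h2
  rw [h.isD] at *
  rw [h2]; omega

theorem Blk.cntD (hd : 1 ≤ d) (h : Blk d s a c) {N v : ℕ} (hv : d * (v + 1) ≤ N) :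
    cnt d N s DStep.D v = a v := by
  unfold cnt
  have hle := h.le v
  rw [mul_add, mul_one] at hv
  rw [show a v = (Finset.range (a v)).card by simp]
  symm
  apply Finset.card_bij (fun r _ => d * v + r)
  · intro r hr
    simp only [Finset.mem_range] at hr
    simp only [Finset.mem_filter, Finset.mem_range]
    have h1 : (d * v + r) / d = v := by
      rw [Nat.mul_add_div hd, Nat.div_eq_of_lt (by omega)]; rfl
    have h2 : (d * v + r) % d = r := by
      rw [Nat.mul_add_mod, Nat.mod_eq_of_lt (by omega)]
    exact ⟨by omega, by rw [h.isD, h1, h2]; exact hr, h1⟩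
  · intro r _ r' _ e; omega
  · intro p hp
    simp only [Finset.mem_filter, Finset.mem_range] at hp
    obtain ⟨h1, h2, h3⟩ := hp
    rw [h.isD, h3] at h2
    have := Nat.div_add_mod p d
    rw [h3] at this
    exact ⟨p % d, by simpa using h2, this⟩

theorem Blk.cntU (hd : 1 ≤ d) (h : Blk d s a c) {N v : ℕ} (hv : d * (v + 1) ≤ N) :
    cnt d N s DStep.U v = c v := by
  unfold cnt
  have hle := h.le v
  rw [mul_add, mul_one] at hv
  rw [show c v = (Finset.range (c v)).card by simp]
  symm
  apply Finset.card_bij (fun r _ => d * v + (d - c v + r))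
  · intro r hr
    simp only [Finset.mem_range] at hr
    simp only [Finset.mem_filter, Finset.mem_range]
    have h1 : (d * v + (d - c v + r)) / d = v := by
      rw [Nat.mul_add_div hd, Nat.div_eq_of_lt (by omega)]; rfl
    have h2 : (d * v + (d - c v + r)) % d = d - c v + r := by
      rw [Nat.mul_add_mod, Nat.mod_eq_of_lt (by omega)]
    exact ⟨by omega, by rw [h.isU, h1, h2]; omega, h1⟩
  · intro r _ r' _ e; omega
  · intro p hp
    simp only [Finset.mem_filter, Finset.mem_range] at hp
    obtain ⟨h1, h2, h3⟩ := hp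
    rw [h.isU, h3] at h2
    have h4 := Nat.div_add_mod p d
    rw [h3] at h4
    have h5 : p % d < d := Nat.mod_lt _ hd
    exact ⟨p % d + c v - d, by simp; omega, by omega⟩

theorem cnt_zero {K v : ℕ} (hd : 1 ≤ d) (x : DStep) (h : K ≤ v) : cnt d (d * K) s x v = 0 := by
  unfold cnt
  rw [Finset.card_eq_zero, Finset.filter_eq_empty_iff]
  rintro p hp ⟨_, h2⟩
  have h3 : p < K * d := by rw [mul_comm]; simpa using hp
  have := (Nat.div_lt_iff_lt_mul hd).2 h3
  omega

theorem cnt_sum (hd : 1 ≤ d) (x : DStep) (v : ℕ) :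
    ((Finset.range (d * v)).filter fun p => s p = x).card =
      ∑ u ∈ Finset.range v, cnt d (d * v) s x u := by
  rw [Finset.card_eq_sum_card_fiberwise (f := fun p => p / d) (t := Finset.range v)]
  · simp only [cnt, Finset.filter_filter]
  · intro p hp
    have hp := (Finset.mem_filter.1 hp).1
    simp only [Finset.mem_range] at hp
    rw [mul_comm] at hp
    simpa using (Nat.div_lt_iff_lt_mul hd).2 hp

theorem Ht_count (s : ℕ → DStep) (k : ℕ) :
    Ht s k = (((Finset.range k).filter fun p => s p = DStep.U).card : ℤ) -
      ((Finset.range k).filter fun p => s p = DStep.D).card := by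
  induction k with
  | zero => simp [Ht]
  | succ k ih =>
    rw [Ht_succ, ih, Finset.range_add_one, Finset.filter_insert, Finset.filter_insert]
    cases h : s k <;> simp [DStep.val] <;> ring

theorem Blk.sumD (hd : 1 ≤ d) (h : Blk d s a c) (v : ℕ) :
    ((Finset.range (d * v)).filter fun p => s p = DStep.D).card = ∑ u ∈ Finset.range v, a u := by
  rw [cnt_sum hd]
  refine Finset.sum_congr rfl fun u hu => h.cntD hd (Nat.mul_le_mul_left d ?_)
  simp at hu; omega

theorem Blk.sumU (hd : 1 ≤ d) (h : Blk d s a c) (v : ℕ) :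
    ((Finset.range (d * v)).filter fun p => s p = DStep.U).card = ∑ u ∈ Finset.range v, c u := by
  rw [cnt_sum hd]
  refine Finset.sum_congr rfl fun u hu => h.cntU hd (Nat.mul_le_mul_left d ?_)
  simp at hu; omega

theorem sum_ldeg (S : Finset (ℕ × ℕ)) (v : ℕ) :
    ∑ u ∈ Finset.range v, ldeg S u = (S.filter fun x => x.2 < v).card := by
  rw [Finset.card_eq_sum_card_fiberwise (f := fun x => x.2) (t := Finset.range v)]
  · refine Finset.sum_congr rfl fun u hu => ?_
    rw [ldeg, Finset.filter_filter]
    congr 1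
    apply Finset.filter_congr
    intro x _
    simp at hu
    constructor
    · rintro rfl; exact ⟨hu, rfl⟩
    · exact fun h => h.2
  · intro p hp
    simpa using (Finset.mem_filter.1 hp).2

theorem sum_rdeg (S : Finset (ℕ × ℕ)) (v : ℕ) :
    ∑ u ∈ Finset.range v, rdeg S u = (S.filter fun x => x.1 < v).card := by
  rw [Finset.card_eq_sum_card_fiberwise (f := fun x => x.1) (t := Finset.range v)]
  · refine Finset.sum_congr rfl fun u hu => ?_
    rw [rdeg, Finset.filter_filter]
    congr 1
    apply Finset.filter_congr
    intro x _
    simp at hu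
    constructor
    · rintro rfl; exact ⟨hu, rfl⟩
    · exact fun h => h.2
  · intro p hp
    simpa using (Finset.mem_filter.1 hp).2

theorem nice_of_stack {m n : ℕ} (hd : 1 ≤ d) {S : Finset (ℕ × ℕ)} (hS : IsStack m d n S)
    (h : Blk d s (ldeg S) (rdeg S)) (hout : ∀ p, d * (n + 2) ≤ p → s p = DStep.L) :
    Nice d (d * (n + 2)) s := by
  refine ⟨fun k => ?_, hout, ?_, h.up, h.dn⟩
  · rw [Ht_count]
    have hk := Nat.div_add_mod k d
    have hk' : k % d < d := Nat.mod_lt _ hd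
    have h1 : ((Finset.range k).filter fun p => s p = DStep.D).card ≤
        ((Finset.range (d * (k / d + 1))).filter fun p => s p = DStep.D).card := by
      apply Finset.card_le_card
      apply Finset.filter_subset_filter
      apply Finset.range_subset_range.2
      rw [mul_add]; omega
    have h2 : ((Finset.range (d * (k / d))).filter fun p => s p = DStep.U).card ≤
        ((Finset.range k).filter fun p => s p = DStep.U).card := by
      apply Finset.card_le_card
      apply Finset.filter_subset_filter
      apply Finset.range_subset_range.2
      omega
    rw [h.sumD hd, sum_ldeg] at h1
    rw [h.sumU hd, sum_rdeg] at h2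
    have h3 : (S.filter fun x => x.2 < k / d + 1).card ≤ (S.filter fun x => x.1 < k / d).card := by
      apply Finset.card_le_card
      intro x hx
      rw [Finset.mem_filter] at hx ⊢
      have := hS.1.1 x hx.1
      exact ⟨hx.1, by omega⟩
    omega
  · rw [Ht_count, h.sumD hd, h.sumU hd, sum_ldeg, sum_rdeg, Finset.filter_true_of_mem,
      Finset.filter_true_of_mem]
    · simp
    · intro x hx
      have := hS.1.1 x hx
      omega
    · intro x hx
      have := hS.1.1 x hx
      omega

theorem hat_eq {n : ℕ} (a0 : a 0 = 0) (c0 : c 0 = 0) (an : a (n + 1) = 0) (cn : c (n + 1) = 0) :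
    hatPath d 0 0 ((List.range n).flatMap fun i => pc d (a (i + 1)) (c (i + 1))) =
      (List.range (n + 2)).flatMap fun v => pc d (a v) (c v) := by
  rw [List.range_succ, List.flatMap_append, List.range_succ_eq_map, List.flatMap_cons,
    List.flatMap_map]
  simp [hatPath, pc, a0, c0, an, cn]

theorem hat_stepSum (M : List DStep) (k : ℕ) :
    stepSum ((hatPath d 0 0 M).take k) = stepSum (M.take (k - d)) := by
  simp [hatPath, List.take_append, List.take_replicate, stepSum_append, stepSum_replicate_L]

end Words
section Final

variable {m d n : ℕ} {S : Finset (ℕ × ℕ)}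

theorem ldeg_zero (hS : IsStack m d n S) {v : ℕ} (hv : v = 0 ∨ n < v) : ldeg S v = 0 := by
  rw [ldeg, Finset.card_eq_zero, Finset.filter_eq_empty_iff]
  intro x hx h
  have := hS.1.1 x hx
  omega

theorem rdeg_zero (hS : IsStack m d n S) {v : ℕ} (hv : v = 0 ∨ n < v) : rdeg S v = 0 := by
  rw [rdeg, Finset.card_eq_zero, Finset.filter_eq_empty_iff]
  intro x hx h
  have := hS.1.1 x hx
  omega

theorem deg_le (hS : IsStack m d n S) (v : ℕ) : ldeg S v + rdeg S v ≤ d := by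
  have h := hS.1.2.2 v
  rw [Finset.filter_or, Finset.card_union_of_disjoint] at h
  · unfold ldeg rdeg; omega
  · rw [Finset.disjoint_filter]
    intro x hx h1 h2
    have := hS.1.1 x hx
    omega

theorem eta_hat (hS : IsStack m d n S) : hatPath d 0 0 (eta d n S) =
    (List.range (n + 2)).flatMap fun v => pc d (ldeg S v) (rdeg S v) :=
  hat_eq (ldeg_zero hS (Or.inl rfl)) (rdeg_zero hS (Or.inl rfl))
    (ldeg_zero hS (Or.inr (by omega))) (rdeg_zero hS (Or.inr (by omega)))

theorem sqn_out {w : List DStep} {p : ℕ} (h : w.length ≤ p) : sqn w p = DStep.L := by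
  by_contra hc
  have := sqn_lt hc
  omega

theorem eta_blk (hd : 1 ≤ d) (hS : IsStack m d n S) :
    Blk d (sqn (hatPath d 0 0 (eta d n S))) (ldeg S) (rdeg S) := by
  rw [eta_hat hS]
  exact blk_flat hd (deg_le hS) (fun v hv => ldeg_zero hS (Or.inr (by omega)))
    (fun v hv => rdeg_zero hS (Or.inr (by omega)))

theorem eta_nice (hd : 1 ≤ d) (hS : IsStack m d n S) :
    Nice d (d * (n + 2)) (sqn (hatPath d 0 0 (eta d n S))) := by
  refine nice_of_stack hd hS (eta_blk hd hS) fun p hp => sqn_out ?_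
  rw [eta_hat hS, flat_length (d := d) fun v => pc_length (deg_le hS v)]
  exact hp

theorem eta_mult (hd : 1 ≤ d) (hS : IsStack m d n S) (i j : ℕ) :
    mult d (d * (n + 2)) (sqn (hatPath d 0 0 (eta d n S))) i j =
      if (i, j) ∈ S then 1 else 0 := by
  have hlt : n < d * (n + 2) := by nlinarith
  refine mult_eq_stack (eta_nice hd hS) hlt hS (fun v => ?_) (fun v => ?_) i j
  · rcases Nat.lt_or_ge v (n + 2) with h | h
    · exact (eta_blk hd hS).cntU hd (Nat.mul_le_mul_left d (by omega))
    · rw [cnt_zero hd _ h, rdeg_zero hS (Or.inr (by omega))]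
  · rcases Nat.lt_or_ge v (n + 2) with h | h
    · exact (eta_blk hd hS).cntD hd (Nat.mul_le_mul_left d (by omega))
    · rw [cnt_zero hd _ h, ldeg_zero hS (Or.inr (by omega))]

theorem eta_good (hd : 1 ≤ d) (hS : IsStack m d n S) : IsGoodPath m d n 0 0 (eta d n S) := by
  have hN := eta_nice hd hS
  have hmu := eta_mult hd hS
  have hlen : ∀ i, (pc d (ldeg S (i + 1)) (rdeg S (i + 1))).length = d :=
    fun i => pc_length (deg_le hS _)
  have hL : (eta d n S).length = d * n := flat_length hlen n
  refine ⟨⟨hL, ?_, ?_, ?_⟩, ?_, ?_⟩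
  · intro i hi
    have h1 := deg_le hS (i + 1)
    exact ⟨ldeg S (i + 1), d - ldeg S (i + 1) - rdeg S (i + 1), rdeg S (i + 1), by omega,
      flat_block hlen n i hi⟩
  · have := hN.fin
    rw [Ht_sq, hat_stepSum, List.take_of_length_le] at this
    · simpa using this
    · rw [hL, mul_add]; omega
  · intro k _
    have := hN.pos (k + d)
    rw [Ht_sq, hat_stepSum, Nat.add_sub_cancel] at this
    simpa using this
  · intro h
    rw [short_iff] at h
    obtain ⟨q, p, h1, h2⟩ := h.mt hd
    have h3 := (mult_ne hN).2 ⟨q, p, h1, rfl, rfl⟩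
    rw [hmu] at h3
    have h4 : (q / d, p / d) ∈ S := by simpa using h3
    have := hS.2 _ h4
    simp only at this
    omega
  · rw [lam_iff]
    apply not_lam_of_mult hN
    intro i j
    rw [hmu]
    split_ifs <;> omega

theorem eta_inj (hd : 1 ≤ d) {T : Finset (ℕ × ℕ)} (hS : IsStack m d n S) (hT : IsStack m d n T)
    (h : eta d n S = eta d n T) : S = T := by
  ext ⟨i, j⟩
  have h1 := eta_mult hd hS i j
  have h2 := eta_mult hd hT i j
  rw [h, h2] at h1
  split_ifs at h1 <;> simp_all

theorem eta_surj (hd : 1 ≤ d) {M : List DStep} (hM : IsGoodPath m d n 0 0 M) :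
    ∃ S, IsStack m d n S ∧ eta d n S = M := by
  obtain ⟨⟨hlen, hpc, hsum, hpos⟩, hreg, hlam⟩ := hM
  have hex : ∀ v, ∃ a c : ℕ, a + c ≤ d ∧ ((v = 0 ∨ n < v) → a = 0 ∧ c = 0) ∧
      (1 ≤ v → v ≤ n → (M.drop (d * (v - 1))).take d = pc d a c) := by
    intro v
    by_cases hv : v = 0 ∨ n < v
    · exact ⟨0, 0, by omega, by simp, by omega⟩
    · obtain ⟨a, b, c, h1, h2⟩ := hpc (v - 1) (by omega)
      refine ⟨a, c, by omega, by tauto, fun _ _ => ?_⟩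
      rw [h2, pc, show d - a - c = b by omega]
  choose a c hle hz hblk using hex
  have hMeq : M = (List.range n).flatMap fun i => pc d (a (i + 1)) (c (i + 1)) := by
    apply flat_unique n M hlen
    intro i hi
    exact hblk (i + 1) (by omega) (by omega)
  have hhat : hatPath d 0 0 M = (List.range (n + 2)).flatMap fun v => pc d (a v) (c v) := by
    rw [hMeq]
    exact hat_eq (hz 0 (Or.inl rfl)).1 (hz 0 (Or.inl rfl)).2
      (hz (n + 1) (Or.inr (by omega))).1 (hz (n + 1) (Or.inr (by omega))).2
  have hB : Blk d (sqn (hatPath d 0 0 M)) a c := by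
    rw [hhat]
    exact blk_flat hd hle (fun v hv => (hz v (Or.inr (by omega))).1)
      (fun v hv => (hz v (Or.inr (by omega))).2)
  have hN : Nice d (d * (n + 2)) (sqn (hatPath d 0 0 M)) := by
    refine ⟨fun k => ?_, fun p hp => sqn_out ?_, ?_, hB.up, hB.dn⟩
    · rw [Ht_sq, hat_stepSum]
      rcases Nat.le_total (k - d) M.length with h | h
      · simpa using hpos _ h
      · rw [List.take_of_length_le h]
        have := hpos M.length le_rfl
        simpa using this
    · rw [hhat, flat_length (d := d) fun v => pc_length (hle v)]
      exact hp
    · rw [Ht_sq, hat_stepSum, List.take_of_length_le]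
      · simpa using hsum
      · rw [hlen, mul_add]; omega
  rw [lam_iff] at hlam
  rw [RegularWord, short_iff] at hreg
  set s := sqn (hatPath d 0 0 M) with hs
  have cU : ∀ v, cnt d (d * (n + 2)) s DStep.U v = c v := by
    intro v
    rcases Nat.lt_or_ge v (n + 2) with h | h
    · exact hB.cntU hd (Nat.mul_le_mul_left d (by omega))
    · rw [cnt_zero hd _ h, (hz v (Or.inr (by omega))).2]
  have cD : ∀ v, cnt d (d * (n + 2)) s DStep.D v = a v := by
    intro v
    rcases Nat.lt_or_ge v (n + 2) with h | h
    · exact hB.cntD hd (Nat.mul_le_mul_left d (by omega))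
    · rw [cnt_zero hd _ h, (hz v (Or.inr (by omega))).1]
  refine ⟨stackOf d (d * (n + 2)) s, stackOf_isStack hd hN hlam hreg ?_ ?_, ?_⟩
  · intro p hp
    by_contra hc
    have h0 := hz (p / d) (by
      generalize p / d = x at hc
      omega)
    have h1 := hB.isD p
    have h2 := hB.isU p
    rw [h0.1] at h1
    rw [h0.2] at h2
    have h3 : p % d < d := Nat.mod_lt _ hd
    cases hsp : s p
    · have := h2.1 hsp; omega
    · have := h1.1 hsp; omega
    · exact hp hsp
  · intro v
    rw [cU, cD]
    have := hle v
    omega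
  · conv_rhs => rw [hMeq]
    unfold eta
    simp only [stackOf_rdeg hN hlam, stackOf_ldeg hN hlam, cU, cD]
    rfl

theorem sCount_eq (hd : 1 ≤ d) : sCount m d n = gCount m d n 0 0 := by
  unfold sCount gCount
  apply Set.ncard_congr (fun S _ => eta d n S)
  · intro S hS
    exact eta_good hd hS
  · intro S T hS hT h
    exact eta_inj hd hS hT h
  · intro M hM
    obtain ⟨S, hS, h⟩ := eta_surj hd hM
    exact ⟨S, hS, h⟩

end Final

theorem stmt12 (m d : ℕ) (hm : 1 ≤ m) (hd : 1 ≤ d) :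
    (PowerSeries.mk fun N => if d ∣ N then ((sCount m d (N / d) : ℤ)) else 0) =
      Gps m d 0 0 ∧
    ∀ n : ℕ, sCount m d n = gCount m d n 0 0 := by
  refine ⟨?_, fun n => sCount_eq hd⟩
  unfold Gps
  simp only [sCount_eq hd]
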